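/- Let A be a nonempty set in ℝ^n and let T be a 2-separating tree of A. Then the number of leaves of T is at most Σ(A). -/

import Mathlib

open MeasureTheory Filter
open scoped ENNReal NNReal Pointwise BigOperators

/-- The closed octant in `ℝ^n` with vertex `z` and signs `θ`. -/
def octant {n : ℕ} (θ z : Fin n → ℝ) : Set (Fin n → ℝ) :=
  {x | ∀ i, 0 ≤ (x i - z i) * θ i}

/-- The coordinate convex hull of `A`: what remains of `ℝ^n` after removing all closed
octants disjoint from `A`; equivalently, the points `x` such that every octant containing `x`
intersects `A`. -/
def cconv {n : ℕ} (A : Set (Fin n → ℝ)) : Set (Fin n → ℝ) :=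
  {x | ∀ θ z : Fin n → ℝ, (∀ i, θ i = 1 ∨ θ i = -1) → x ∈ octant θ z →
    (octant θ z ∩ A).Nonempty}

/-- The coordinate projection of `ℝ^n` onto `ℝ^σ`. -/
def coordProj {n : ℕ} (σ : Finset (Fin n)) (x : Fin n → ℝ) : Fin n → ℝ :=
  fun i => if i ∈ σ then x i else 0

/-- The integer cell `a + [0,1]^σ` in `ℝ^σ` (realized inside `ℝ^n` with zero coordinates
off `σ`). -/
def intCell {n : ℕ} (σ : Finset (Fin n)) (a : Fin n → ℤ) : Set (Fin n → ℝ) :=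
  {x | (∀ i ∈ σ, (a i : ℝ) ≤ x i ∧ x i ≤ (a i : ℝ) + 1) ∧ ∀ i ∉ σ, x i = 0}

/-- The cell content `Σ(A)`: the total number of integer cells contained in the coordinate
convex hulls of all coordinate projections of `A` (the summand for `σ = ∅` equals `1`
exactly when `A` is nonempty). -/
noncomputable def cellContent {n : ℕ} (A : Set (Fin n → ℝ)) : ℝ≥0∞ :=
  ∑ σ : Finset (Fin n),
    (({a : Fin n → ℤ | (∀ i ∉ σ, a i = 0) ∧ intCell σ a ⊆ cconv (coordProj σ '' A)}.encard :
      ℕ∞) : ℝ≥0∞)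

/-- The covering number `N(K,D)`: the minimal number of translates of `D` needed to cover
`K`. -/
noncomputable def coveringNumber {n : ℕ} (K D : Set (Fin n → ℝ)) : ℕ∞ :=
  ⨅ (m : ℕ) (_ : ∃ x : Fin m → Fin n → ℝ, K ⊆ ⋃ j, (fun y => x j + y) '' D), (m : ℕ∞)

variable {E : Type*}

/-- `B'` is a son of `B` in the tree `T`: a maximal (w.r.t. inclusion) proper subset of `B`
belonging to `T`. -/
def IsSon (T : Finset (Set E)) (B' B : Set E) : Prop :=
  B' ∈ T ∧ B ∈ T ∧ B' ⊂ B ∧ ∀ C ∈ T, C ⊂ B → B' ⊆ C → C = B'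

/-- `B` is a leaf of the tree `T`: an element with no sons. -/
def IsLeaf (T : Finset (Set E)) (B : Set E) : Prop :=
  B ∈ T ∧ ∀ B', ¬IsSon T B' B

/-- `B` is a root of the tree `T`: an element which is not a son of any other element. -/
def IsRoot (T : Finset (Set E)) (B : Set E) : Prop :=
  B ∈ T ∧ ∀ B'', ¬IsSon T B B''

/-- `T` is a `t`-separating tree of `A ⊆ ℝ^n`: a finite collection of nonempty subsets of `A`,
any two of which are disjoint or nested, whose only root is `A`, and in which every non-leaf
element has exactly two sons `B₊`, `B₋` that are `t`-separated on some coordinate. -/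
def IsSeparatingTree {n : ℕ} (t : ℝ) (A : Set (Fin n → ℝ)) (T : Finset (Set (Fin n → ℝ))) :
    Prop :=
  (∀ B ∈ T, B ⊆ A ∧ B.Nonempty) ∧
  (∀ B ∈ T, ∀ C ∈ T, Disjoint B C ∨ B ⊆ C ∨ C ⊆ B) ∧
  (∀ B, IsRoot T B ↔ B = A) ∧
  (∀ B ∈ T, ¬IsLeaf T B →
    ∃ Bp Bm, Bp ≠ Bm ∧ IsSon T Bp B ∧ IsSon T Bm B ∧
      (∀ C, IsSon T C B → C = Bp ∨ C = Bm) ∧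
      ∃ i : Fin n, ∀ f ∈ Bp, ∀ g ∈ Bm, g i + t ≤ f i)

def cellSet {n : ℕ} (A : Set (Fin n → ℝ)) : Set (Finset (Fin n) × (Fin n → ℤ)) :=
  {p | (∀ i ∉ p.1, p.2 i = 0) ∧ intCell p.1 p.2 ⊆ cconv (coordProj p.1 '' A)}

lemma cellContent_eq {n : ℕ} (A : Set (Fin n → ℝ)) :
    cellContent A = ((cellSet A).encard : ℝ≥0∞) := by
  have h : cellSet A = ⋃ σ : Finset (Fin n), (Prod.mk σ) ''
      {a : Fin n → ℤ | (∀ i ∉ σ, a i = 0) ∧ intCell σ a ⊆ cconv (coordProj σ '' A)} := by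
    ext ⟨σ, a⟩
    simp [cellSet]
  rw [h, Set.encard_iUnion_of_finite, finsum_eq_sum_of_fintype]
  · unfold cellContent
    change _ = ENat.toENNRealRingHom _
    rw [map_sum]
    refine Finset.sum_congr rfl fun σ _ => ?_
    rw [Function.Injective.encard_image (Prod.mk_right_injective σ)]
    rfl
  · intro σ τ hst
    simp only [Function.onFun]
    rw [Set.disjoint_left]
    rintro _ ⟨a, -, rfl⟩ ⟨b, -, hb⟩
    exact hst (congrArg Prod.fst hb).symm

lemma cconv_mono {n : ℕ} {A B : Set (Fin n → ℝ)} (h : A ⊆ B) : cconv A ⊆ cconv B := by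
  intro x hx θ z hθ hz
  exact (hx θ z hθ hz).mono (Set.inter_subset_inter_right _ h)

lemma cellSet_mono {n : ℕ} {A B : Set (Fin n → ℝ)} (h : A ⊆ B) : cellSet A ⊆ cellSet B :=
  fun _ hp => ⟨hp.1, hp.2.trans (cconv_mono (Set.image_mono h))⟩

lemma cconv_lower {n : ℕ} {A : Set (Fin n → ℝ)} {σ : Finset (Fin n)} {i : Fin n} (hi : i ∈ σ)
    {c : ℝ} (hc : ∀ f ∈ A, c ≤ f i) {x : Fin n → ℝ} (hx : x ∈ cconv (coordProj σ '' A)) :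
    c ≤ x i := by
  obtain ⟨_, h1, f, hf, rfl⟩ := hx (fun _ => -1) x (fun _ => Or.inr rfl) (fun j => by simp)
  have := h1 i
  simp only [coordProj, hi, if_true] at this
  linarith [hc f hf]

lemma cconv_upper {n : ℕ} {A : Set (Fin n → ℝ)} {σ : Finset (Fin n)} {i : Fin n} (hi : i ∈ σ)
    {c : ℝ} (hc : ∀ f ∈ A, f i ≤ c) {x : Fin n → ℝ} (hx : x ∈ cconv (coordProj σ '' A)) :
    x i ≤ c := by
  obtain ⟨_, h1, f, hf, rfl⟩ := hx (fun _ => 1) x (fun _ => Or.inl rfl) (fun j => by simp)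
  have := h1 i
  simp only [coordProj, hi, if_true] at this
  linarith [hc f hf]

lemma cell_lower {n : ℕ} {A : Set (Fin n → ℝ)} {p : Finset (Fin n) × (Fin n → ℤ)} {i : Fin n}
    (hi : i ∈ p.1) {c : ℝ} (hc : ∀ f ∈ A, c ≤ f i) (hp : p ∈ cellSet A) : c ≤ p.2 i := by
  refine cconv_lower hi hc (hp.2 (?_ : (fun j => (p.2 j : ℝ)) ∈ _))
  refine ⟨fun j _ => ⟨le_rfl, by simp⟩, fun j hj => by simp [hp.1 j hj]⟩

lemma cell_upper {n : ℕ} {A : Set (Fin n → ℝ)} {p : Finset (Fin n) × (Fin n → ℤ)} {i : Fin n}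
    (hi : i ∈ p.1) {c : ℝ} (hc : ∀ f ∈ A, f i ≤ c) (hp : p ∈ cellSet A) : p.2 i + 1 ≤ c := by
  have := cconv_upper hi hc (hp.2 (?_ : (fun j => if j ∈ p.1 then (p.2 j : ℝ) + 1 else 0) ∈ _))
  · simpa [hi] using this
  refine ⟨fun j hj => by simp [hj], fun j hj => by simp [hj]⟩

lemma cell_new {n : ℕ} {A Ap Am : Set (Fin n → ℝ)} (hp : Ap ⊆ A) (hm : Am ⊆ A)
    {σ : Finset (Fin n)} {a : Fin n → ℤ} {i : Fin n} (hi : i ∉ σ) {k : ℤ}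
    (hkp : ∀ f ∈ Ap, (k : ℝ) + 1 ≤ f i) (hkm : ∀ f ∈ Am, f i ≤ (k : ℝ))
    (h1 : (σ, a) ∈ cellSet Ap) (h2 : (σ, a) ∈ cellSet Am) :
    (insert i σ, Function.update a i k) ∈ cellSet A := by
  refine ⟨?_, ?_⟩
  · intro j hj
    simp only [Finset.mem_insert, not_or] at hj
    simp only [Function.update_of_ne hj.1]
    exact h1.1 j hj.2
  rintro x ⟨hx1, hx2⟩ θ z hθ hz
  have hxi := hx1 i (Finset.mem_insert_self _ _)
  simp only [Function.update_self] at hxi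
  have hx' : Function.update x i 0 ∈ intCell σ a := by
    refine ⟨fun j hj => ?_, fun j hj => ?_⟩
    · have hji : j ≠ i := fun h => hi (h ▸ hj)
      have := hx1 j (Finset.mem_insert_of_mem hj)
      simpa [Function.update_of_ne hji] using this
    · by_cases hji : j = i
      · subst hji; simp
      · simpa [Function.update_of_ne hji] using hx2 j (by simp [hji, hj])
  have hz' : Function.update x i 0 ∈ octant θ (Function.update z i 0) := by
    intro j
    by_cases hji : j = i
    · subst hji; simp
    · simpa [Function.update_of_ne hji] using hz j
  have key : ∀ f ∈ A, coordProj σ f ∈ octant θ (Function.update z i 0) →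
      0 ≤ (f i - z i) * θ i → (octant θ z ∩ coordProj (insert i σ) '' A).Nonempty := by
    intro f hf h h'
    refine ⟨_, ?_, f, hf, rfl⟩
    intro j
    by_cases hji : j = i
    · subst hji; simpa [coordProj] using h'
    · have := h j
      simpa [coordProj, Function.update_of_ne hji, hji] using this
  have hzi := hz i
  rcases hθ i with ht | ht
  · obtain ⟨_, h3, f, hf, rfl⟩ := h1.2 hx' θ _ hθ hz'
    refine key f (hp hf) h3 ?_
    rw [ht] at hzi ⊢
    linarith [hkp f hf]
  · obtain ⟨_, h3, f, hf, rfl⟩ := h2.2 hx' θ _ hθ hz'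
    refine key f (hm hf) h3 ?_
    rw [ht] at hzi ⊢
    linarith [hkm f hf]

lemma cell_add {n : ℕ} {A Ap Am : Set (Fin n → ℝ)} (hp : Ap ⊆ A) (hm : Am ⊆ A)
    (nep : Ap.Nonempty) (nem : Am.Nonempty) (i : Fin n)
    (hsep : ∀ f ∈ Ap, ∀ g ∈ Am, g i + 2 ≤ f i) :
    (cellSet Ap).encard + (cellSet Am).encard ≤ (cellSet A).encard := by
  obtain ⟨k, hkp, hkm⟩ : ∃ k : ℤ, (∀ f ∈ Ap, (k : ℝ) + 1 ≤ f i) ∧ ∀ f ∈ Am, f i ≤ (k : ℝ) := by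
    set s := sSup ((fun g : Fin n → ℝ => g i) '' Am) with hs
    obtain ⟨f0, hf0⟩ := nep
    have hb : BddAbove ((fun g : Fin n → ℝ => g i) '' Am) := by
      refine ⟨f0 i, ?_⟩
      rintro _ ⟨g, hg, rfl⟩
      have := hsep f0 hf0 g hg
      simp only
      linarith
    refine ⟨⌈s⌉, fun f hf => ?_, fun g hg => ?_⟩
    · have h1 : s ≤ f i - 2 := by
        refine csSup_le (nem.image _) ?_
        rintro _ ⟨g, hg, rfl⟩
        have := hsep f hf g hg
        simp only
        linarith
      linarith [Int.ceil_lt_add_one s]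
    · exact (le_csSup hb ⟨g, hg, rfl⟩).trans (Int.le_ceil s)
  have hni : ∀ p ∈ cellSet Ap ∩ cellSet Am, i ∉ p.1 := by
    intro p hpp hi
    linarith [cell_lower hi hkp hpp.1, cell_upper hi hkm hpp.2]
  let φ : Finset (Fin n) × (Fin n → ℤ) → Finset (Fin n) × (Fin n → ℤ) :=
    fun p => (insert i p.1, Function.update p.2 i k)
  have hinj : Set.InjOn φ (cellSet Ap ∩ cellSet Am) := by
    rintro ⟨σ, a⟩ h1 ⟨τ, b⟩ h2 h
    have i1 := hni _ h1
    have i2 := hni _ h2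
    have a1 := h1.1.1 i i1
    have a2 := h2.1.1 i i2
    simp only [φ, Prod.mk.injEq] at h i1 i2 a1 a2 ⊢
    refine ⟨?_, ?_⟩
    · rw [← Finset.erase_insert i1, h.1, Finset.erase_insert i2]
    · funext j
      by_cases hj : j = i
      · subst hj; rw [a1, a2]
      · simpa [Function.update_of_ne hj] using congrFun h.2 j
  have hdisj : Disjoint (cellSet Ap ∪ cellSet Am) (φ '' (cellSet Ap ∩ cellSet Am)) := by
    rw [Set.disjoint_right]
    rintro _ ⟨p, -, rfl⟩ (h | h)
    · have := cell_lower (i := i) (by simp [φ]) hkp h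
      simp only [φ, Function.update_self] at this
      linarith
    · have := cell_upper (i := i) (by simp [φ]) hkm h
      simp only [φ, Function.update_self] at this
      linarith
  rw [← Set.encard_union_add_encard_inter, ← hinj.encard_image, ← Set.encard_union_eq hdisj]
  refine Set.encard_le_encard (Set.union_subset (Set.union_subset (cellSet_mono hp)
    (cellSet_mono hm)) ?_)
  rintro _ ⟨p, hpp, rfl⟩
  exact cell_new hp hm (hni p hpp) hkp hkm hpp.1 hpp.2

lemma one_le_cell {n : ℕ} {A : Set (Fin n → ℝ)} (hA : A.Nonempty) : 1 ≤ (cellSet A).encard := by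
  rw [Set.one_le_encard_iff_nonempty]
  obtain ⟨f, hf⟩ := hA
  refine ⟨(∅, 0), by simp, ?_⟩
  rintro x ⟨-, hx⟩ θ z hθ hz
  have : x = coordProj ∅ f := by
    funext j
    simpa [coordProj] using hx j
  exact ⟨x, hz, f, hf, this.symm⟩

lemma exists_son {E : Type*} {T : Finset (Set E)} {L B : Set E} (hL : L ∈ T) (hB : B ∈ T)
    (h : L ⊂ B) : ∃ C, IsSon T C B ∧ L ⊆ C := by
  have hfin : {C | C ∈ T ∧ C ⊂ B}.Finite := T.finite_toSet.subset fun C hC => hC.1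
  obtain ⟨C, hLC, hC⟩ := hfin.exists_le_maximal (a := L) ⟨hL, h⟩
  refine ⟨C, ⟨hC.prop.1, hB, hC.prop.2, fun D hD hDB hCD => ?_⟩, hLC⟩
  exact (hC.eq_of_le ⟨hD, hDB⟩ hCD).symm

lemma leaves_aux {n : ℕ} {A : Set (Fin n → ℝ)} {T : Finset (Set (Fin n → ℝ))}
    (hT : IsSeparatingTree 2 A T) (N : ℕ) : ∀ B ∈ T, {C ∈ (T : Set _) | C ⊆ B}.ncard ≤ N →
      {L | IsLeaf T L ∧ L ⊆ B}.encard ≤ (cellSet B).encard := by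
  induction N with
  | zero =>
    intro B hB h
    have hfin : {C ∈ (T : Set _) | C ⊆ B}.Finite := T.finite_toSet.subset fun C hC => hC.1
    have := (Set.ncard_eq_zero hfin).1 (Nat.le_zero.1 h)
    exact absurd (this ▸ (⟨hB, subset_rfl⟩ : B ∈ {C ∈ (T : Set _) | C ⊆ B})) (Set.notMem_empty B)
  | succ N ih =>
    intro B hB hcard
    have hfin : {C ∈ (T : Set _) | C ⊆ B}.Finite := T.finite_toSet.subset fun C hC => hC.1
    have ih' : ∀ C, IsSon T C B →
        {L | IsLeaf T L ∧ L ⊆ C}.encard ≤ (cellSet C).encard := by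
      intro C hC
      refine ih C hC.1 ?_
      have : {D ∈ (T : Set _) | D ⊆ C}.ncard < {C ∈ (T : Set _) | C ⊆ B}.ncard := by
        refine Set.ncard_lt_ncard ?_ hfin
        refine (Set.ssubset_iff_of_subset ?_).2 ⟨B, ⟨hB, subset_rfl⟩, fun h => hC.2.2.1.2 h.2⟩
        exact fun D hD => ⟨hD.1, hD.2.trans hC.2.2.1.1⟩
      omega
    by_cases hl : IsLeaf T B
    · refine le_trans ?_ (one_le_cell (hT.1 B hB).2)
      rw [← Set.encard_singleton B]
      refine Set.encard_le_encard ?_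
      rintro L ⟨hL, hLB⟩
      by_contra hne
      obtain ⟨C, hC, -⟩ := exists_son hL.1 hB (lt_of_le_of_ne hLB hne)
      exact hl.2 C hC
    · obtain ⟨Bp, Bm, -, hp, hm, hall, i, hsep⟩ := hT.2.2.2 B hB hl
      refine le_trans ?_ (cell_add hp.2.2.1.1 hm.2.2.1.1 (hT.1 _ hp.1).2 (hT.1 _ hm.1).2 i hsep)
      refine le_trans ?_ (add_le_add (ih' _ hp) (ih' _ hm))
      refine le_trans (Set.encard_le_encard ?_) (Set.encard_union_le _ _)
      rintro L ⟨hL, hLB⟩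
      obtain ⟨C, hC, hLC⟩ := exists_son hL.1 hB
        (lt_of_le_of_ne hLB (fun h => hl (h ▸ hL)))
      rcases hall C hC with rfl | rfl
      · exact Or.inl ⟨hL, hLC⟩
      · exact Or.inr ⟨hL, hLC⟩

/-- If `T` is a `2`-separating tree of a nonempty set `A ⊆ ℝ^n`, then the
number of leaves of `T` is at most the cell content `Σ(A)`. -/
theorem leaves_le_cellContent :
    ∀ (n : ℕ) (A : Set (Fin n → ℝ)) (T : Finset (Set (Fin n → ℝ))),
      A.Nonempty → IsSeparatingTree 2 A T →
      (({B : Set (Fin n → ℝ) | B ∈ T ∧ IsLeaf T B}.encard : ℕ∞) : ℝ≥0∞) ≤ cellContent A := by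
  intro n A T _ hT
  have hA : A ∈ T := ((hT.2.2.1 A).2 rfl).1
  rw [cellContent_eq, ENat.toENNReal_le]
  refine le_trans (Set.encard_le_encard ?_) (leaves_aux hT _ A hA le_rfl)
  exact fun L hL => ⟨hL.2, (hT.1 L hL.1).1⟩
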